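/- arXiv:1004.0400 — 3 statements merged into one kernel-verified Lean document; each statement's English description precedes it below -/
import Mathlib

section
/- For every d ∈ [0,1] and all integers n, m ≥ 1, the quantity n·C_n(d) is subadditive in n: (n+m)·C_{n+m}(d) ≤ n·C_n(d) + m·C_m(d). -/
open scoped BigOperators

noncomputable section

/-- Output alphabet of the binary deletion channel with `n` input bits:
a length `k ≤ n` together with a binary string of that length. -/
abbrev DelOut (n : ℕ) := Σ k : Fin (n + 1), (Fin (k : ℕ) → Bool)

/-- The subsequence of `x` indexed by `S` (taken in increasing order),
as an element of `DelOut n`. -/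
def restrictSub {n : ℕ} (x : Fin n → Bool) (S : Finset (Fin n)) : DelOut n :=
  ⟨⟨S.card, Nat.lt_succ_of_le (by simpa using Finset.card_le_univ S)⟩,
   fun i => x (S.orderEmbOfFin rfl i)⟩

/-- Transition probability of the binary deletion channel `W_n^d`: each input bit is
deleted independently with probability `d`. -/
def delW {n : ℕ} (d : ℝ) (x : Fin n → Bool) (y : DelOut n) : ℝ :=
  ∑ S : Finset (Fin n),
    if restrictSub x S = y then (1 - d) ^ S.card * d ^ (n - S.card) else 0

/-- Transition probability of the exact deletion channel `W_{n,k}`, which keeps exactly `k`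
of the `n` input bits, the kept positions being a uniformly random `k`-subset; `k`-subsets
are identified with strictly monotone maps `Fin k → Fin n`. -/
def exactW {n k : ℕ} (x : Fin n → Bool) (y : Fin k → Bool) : ℝ :=
  ((Finset.univ.filter fun f : Fin k → Fin n => StrictMono f ∧ x ∘ f = y).card : ℝ) /
    (n.choose k : ℝ)

/-- `p` is a probability distribution on the finite alphabet `α`. -/
def IsDist {α : Type*} [Fintype α] (p : α → ℝ) : Prop :=
  (∀ a, 0 ≤ p a) ∧ ∑ a, p a = 1

/-- Base-2 mutual information `I(X;Y)` between the input `X ~ p` and the output `Y`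
of the channel with transition matrix `W`. -/
def mutualInfo {α β : Type*} [Fintype α] [Fintype β] (p : α → ℝ) (W : α → β → ℝ) : ℝ :=
  ∑ x, ∑ y, p x * W x y * Real.logb 2 (W x y / ∑ x', p x' * W x' y)

/-- `C_n(d) = (1/n) · sup_p I(X ; W_n^d(X))`. -/
def Cn (n : ℕ) (d : ℝ) : ℝ :=
  (1 / (n : ℝ)) * ⨆ p : {p : (Fin n → Bool) → ℝ // IsDist p}, mutualInfo p.1 (delW d)

/-- `C_{n,k} = (1/n) · sup_p I(X ; W_{n,k}(X))`. -/
def Cnk (n k : ℕ) : ℝ :=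
  (1 / (n : ℝ)) * ⨆ p : {p : (Fin n → Bool) → ℝ // IsDist p},
    mutualInfo p.1 (exactW (n := n) (k := k))

/-- Capacity of the binary deletion channel: `C(d) = inf_{n ≥ 1} C_n(d)`. -/
def C (d : ℝ) : ℝ := ⨅ n : {m : ℕ // 1 ≤ m}, Cn n d

/-- The law of `f X` when `X ~ p`. -/
def pushDist {α γ : Type*} [Fintype α] [DecidableEq γ] (f : α → γ) (p : α → ℝ) (c : γ) : ℝ :=
  ∑ x, if f x = c then p x else 0

lemma sum_pushDist_mul {α γ : Type*} [Fintype α] [Fintype γ] [DecidableEq γ]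
    (f : α → γ) (p : α → ℝ) (g : γ → ℝ) :
    ∑ c, pushDist f p c * g c = ∑ x, p x * g (f x) := by
  simp_rw [pushDist, Finset.sum_mul]
  rw [Finset.sum_comm]
  simp [ite_mul]

lemma IsDist.pushDist {α γ : Type*} [Fintype α] [Fintype γ] [DecidableEq γ]
    {p : α → ℝ} (hp : IsDist p) (f : α → γ) : IsDist (pushDist f p) := by
  refine ⟨fun c => Finset.sum_nonneg fun x _ => ?_, ?_⟩
  · split_ifs
    exacts [hp.1 x, le_rfl]
  · simpa [hp.2] using sum_pushDist_mul f p fun _ => 1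

lemma mutualInfo_pushDist {α γ β : Type*} [Fintype α] [Fintype γ] [DecidableEq γ] [Fintype β]
    (f : α → γ) (p : α → ℝ) (W : γ → β → ℝ) :
    mutualInfo (pushDist f p) W = mutualInfo p fun x => W (f x) := by
  simp only [mutualInfo, sum_pushDist_mul f p fun c => W c _]
  simp only [mul_assoc, ← Finset.mul_sum]
  exact sum_pushDist_mul f p fun c =>
    ∑ y, W c y * Real.logb 2 (W c y / ∑ x', p x' * W (f x') y)

/-- A crude bound, uniform in the input distribution. -/
lemma mutualInfo_le_card_div_log {α β : Type*} [Fintype α] [Fintype β]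
    {p : α → ℝ} (hp : ∀ x, 0 ≤ p x) {W : α → β → ℝ} (hW : ∀ x, IsDist (W x)) :
    mutualInfo p W ≤ Fintype.card α / Real.log 2 := by
  have hlog : 0 < Real.log 2 := Real.log_pos one_lt_two
  have hterm (x : α) (y : β) :
      p x * W x y * Real.logb 2 (W x y / ∑ x', p x' * W x' y) ≤ W x y / Real.log 2 := by
    have hnonneg (x') : 0 ≤ p x' * W x' y := mul_nonneg (hp x') ((hW x').1 y)
    have hle : p x * W x y ≤ ∑ x', p x' * W x' y :=
      Finset.single_le_sum (f := fun x' => p x' * W x' y) (fun x' _ => hnonneg x')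
        (Finset.mem_univ x)
    have hsum : 0 ≤ ∑ x', p x' * W x' y := (hnonneg x).trans hle
    rw [Real.logb, ← mul_div_assoc]
    gcongr
    calc p x * W x y * Real.log (W x y / ∑ x', p x' * W x' y)
        ≤ p x * W x y * (W x y / ∑ x', p x' * W x' y) :=
          mul_le_mul_of_nonneg_left (Real.log_le_self (div_nonneg ((hW x).1 y) hsum)) (hnonneg x)
      _ = W x y * (p x * W x y / ∑ x', p x' * W x' y) := by ring
      _ ≤ W x y := mul_le_of_le_one_right ((hW x).1 y) (div_le_one_of_le₀ hle hsum)
  calc mutualInfo p W ≤ ∑ x, ∑ y, W x y / Real.log 2 :=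
        Finset.sum_le_sum fun x _ => Finset.sum_le_sum fun y _ => hterm x y
    _ = Fintype.card α / Real.log 2 := by
        simp [div_eq_mul_inv, ← Finset.sum_mul, (hW _).2]

/-- If, given the input, `Y` is a function `c` of two independent outputs `(Y₁, Y₂)`, then
`I(X;Y) ≤ I(X;Y₁) + I(X;Y₂)`. -/
lemma mutualInfo_le_add {α β₁ β₂ β : Type*} [Fintype α] [Fintype β₁] [Fintype β₂] [Fintype β]
    [DecidableEq β] {p : α → ℝ} (hp : IsDist p) {U : α → β₁ → ℝ} {V : α → β₂ → ℝ}
    (hU : ∀ x, IsDist (U x)) (hV : ∀ x, IsDist (V x)) (c : β₁ × β₂ → β) {W : α → β → ℝ}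
    (hW : ∀ x y, W x y = ∑ z, if c z = y then U x z.1 * V x z.2 else 0) :
    mutualInfo p W ≤ mutualInfo p U + mutualInfo p V := by
  have hlog : 0 < Real.log 2 := Real.log_pos one_lt_two
  set u : β₁ → ℝ := fun y => ∑ x, p x * U x y with hu
  set v : β₂ → ℝ := fun y => ∑ x, p x * V x y with hv
  set w : β → ℝ := fun y => ∑ x, p x * W x y with hw
  have hUV (x : α) (z : β₁ × β₂) : 0 ≤ U x z.1 * V x z.2 :=
    mul_nonneg ((hU x).1 _) ((hV x).1 _)
  have hUVW (x : α) (z : β₁ × β₂) : U x z.1 * V x z.2 ≤ W x (c z) := by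
    rw [hW]
    refine le_trans (by simp) (Finset.single_le_sum
      (f := fun z' => if c z' = c z then U x z'.1 * V x z'.2 else 0)
      (fun z' _ => ?_) (Finset.mem_univ z))
    split_ifs
    exacts [hUV x z', le_rfl]
  have hWnonneg (x : α) (z : β₁ × β₂) : 0 ≤ W x (c z) := (hUV x z).trans (hUVW x z)
  have hule (x : α) (y : β₁) : p x * U x y ≤ u y :=
    Finset.single_le_sum (f := fun x => p x * U x y)
      (fun x' _ => mul_nonneg (hp.1 x') ((hU x').1 y)) (Finset.mem_univ x)
  have hvle (x : α) (y : β₂) : p x * V x y ≤ v y :=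
    Finset.single_le_sum (f := fun x => p x * V x y)
      (fun x' _ => mul_nonneg (hp.1 x') ((hV x').1 y)) (Finset.mem_univ x)
  have hwle (x : α) (z : β₁ × β₂) : p x * W x (c z) ≤ w (c z) :=
    Finset.single_le_sum (f := fun x => p x * W x (c z))
      (fun x' _ => mul_nonneg (hp.1 x') (hWnonneg x' z)) (Finset.mem_univ x)
  have hunonneg (y : β₁) : 0 ≤ u y :=
    Finset.sum_nonneg fun x _ => mul_nonneg (hp.1 x) ((hU x).1 y)
  have hvnonneg (y : β₂) : 0 ≤ v y :=
    Finset.sum_nonneg fun x _ => mul_nonneg (hp.1 x) ((hV x).1 y)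
  have hwnonneg (z : β₁ × β₂) : 0 ≤ w (c z) :=
    Finset.sum_nonneg fun x _ => mul_nonneg (hp.1 x) (hWnonneg x z)
  have husum : ∑ y, u y = 1 := by
    rw [hu, Finset.sum_comm]
    simp [← Finset.mul_sum, (hU _).2, hp.2]
  have hvsum : ∑ y, v y = 1 := by
    rw [hv, Finset.sum_comm]
    simp [← Finset.mul_sum, (hV _).2, hp.2]
  have hIW : mutualInfo p W =
      ∑ x, ∑ z, p x * (U x z.1 * V x z.2) * Real.logb 2 (W x (c z) / w (c z)) := by
    refine Finset.sum_congr rfl fun x _ => ?_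
    have hexpand (y : β) : p x * W x y * Real.logb 2 (W x y / w y) =
        ∑ z, if c z = y then p x * (U x z.1 * V x z.2) * Real.logb 2 (W x y / w y) else 0 := by
      conv_lhs => rw [mul_assoc, mul_left_comm, hW x y, Finset.sum_mul]
      refine Finset.sum_congr rfl fun z _ => ?_
      split_ifs
      · rw [← hW x y]; ring
      · ring
    calc _ = ∑ y, ∑ z, if c z = y then
          p x * (U x z.1 * V x z.2) * Real.logb 2 (W x y / w y) else 0 :=
          Finset.sum_congr rfl fun y _ => hexpand y
      _ = _ := by rw [Finset.sum_comm]; simp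
  have hIU : mutualInfo p U =
      ∑ x, ∑ z : β₁ × β₂, p x * (U x z.1 * V x z.2) * Real.logb 2 (U x z.1 / u z.1) := by
    refine Finset.sum_congr rfl fun x _ => ?_
    rw [Fintype.sum_prod_type]
    refine Finset.sum_congr rfl fun y _ => ?_
    rw [← mul_one (p x * U x y * _), ← (hV x).2, Finset.mul_sum]
    exact Finset.sum_congr rfl fun y' _ => by ring
  have hIV : mutualInfo p V =
      ∑ x, ∑ z : β₁ × β₂, p x * (U x z.1 * V x z.2) * Real.logb 2 (V x z.2 / v z.2) := by
    refine Finset.sum_congr rfl fun x _ => ?_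
    rw [Fintype.sum_prod_type_right]
    refine Finset.sum_congr rfl fun y _ => ?_
    rw [← mul_one (p x * V x y * _), ← (hU x).2, Finset.mul_sum]
    exact Finset.sum_congr rfl fun y' _ => by ring
  have hterm (x : α) (z : β₁ × β₂) :
      p x * (U x z.1 * V x z.2) * Real.logb 2 (W x (c z) / w (c z)) ≤
        p x * (U x z.1 * V x z.2) * Real.logb 2 (U x z.1 / u z.1) +
        p x * (U x z.1 * V x z.2) * Real.logb 2 (V x z.2 / v z.2) +
        (u z.1 * v z.2 * (p x * W x (c z) / w (c z)) - p x * (U x z.1 * V x z.2)) /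
          Real.log 2 := by
    rcases (mul_nonneg (hp.1 x) (hUV x z)).eq_or_lt with h0 | hpos
    · simp only [← h0, zero_mul, zero_add, sub_zero]
      have := hp.1 x
      have := hWnonneg x z
      have := hwnonneg z
      have := hunonneg z.1
      have := hvnonneg z.2
      positivity
    · have hpx : 0 < p x := pos_of_mul_pos_left hpos (hUV x z)
      have hUVpos : 0 < U x z.1 * V x z.2 := pos_of_mul_pos_right hpos hpx.le
      have hUpos : 0 < U x z.1 := pos_of_mul_pos_left hUVpos ((hV x).1 _)
      have hVpos : 0 < V x z.2 := pos_of_mul_pos_right hUVpos hUpos.le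
      have hWpos : 0 < W x (c z) := hUVpos.trans_le (hUVW x z)
      have hupos : 0 < u z.1 := (mul_pos hpx hUpos).trans_le (hule x _)
      have hvpos : 0 < v z.2 := (mul_pos hpx hVpos).trans_le (hvle x _)
      have hwpos : 0 < w (c z) := (mul_pos hpx hWpos).trans_le (hwle x z)
      generalize u z.1 = u₀ at *
      generalize v z.2 = v₀ at *
      generalize w (c z) = w₀ at *
      generalize W x (c z) = W₀ at *
      generalize U x z.1 = U₀ at *
      generalize V x z.2 = V₀ at *
      have hkey := Real.log_le_sub_one_of_pos
        (show 0 < (W₀ / w₀) / ((U₀ / u₀) * (V₀ / v₀)) by positivity)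
      rw [Real.log_div (by positivity) (by positivity),
        Real.log_mul (by positivity) (by positivity)] at hkey
      have hmul := mul_le_mul_of_nonneg_left hkey hpos.le
      have hratio : p x * (U₀ * V₀) * (W₀ / w₀ / (U₀ / u₀ * (V₀ / v₀)) - 1) =
          u₀ * v₀ * (p x * W₀ / w₀) - p x * (U₀ * V₀) := by
        field_simp
      rw [hratio] at hmul
      simp only [Real.logb]
      rw [← mul_div_assoc, ← mul_div_assoc, ← mul_div_assoc, ← add_div, ← add_div]
      gcongr
      linarith
  have hgain : ∑ x, ∑ z : β₁ × β₂, u z.1 * v z.2 * (p x * W x (c z) / w (c z)) ≤ 1 := by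
    rw [Finset.sum_comm]
    calc _ ≤ ∑ z : β₁ × β₂, u z.1 * v z.2 := by
          refine Finset.sum_le_sum fun z _ => ?_
          rw [← Finset.mul_sum, ← Finset.sum_div]
          exact mul_le_of_le_one_right (mul_nonneg (hunonneg _) (hvnonneg _))
            (div_self_le_one (w (c z)))
      _ = 1 := by
          rw [Fintype.sum_prod_type]
          simp [← Finset.mul_sum, husum, hvsum]
  have htotal : ∑ x, ∑ z : β₁ × β₂, p x * (U x z.1 * V x z.2) = 1 := by
    simp [Fintype.sum_prod_type, ← Finset.mul_sum, (hU _).2, (hV _).2, hp.2]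
  have hsum := Finset.sum_le_sum fun x (_ : x ∈ Finset.univ) =>
    Finset.sum_le_sum fun z (_ : z ∈ Finset.univ) => hterm x z
  simp only [Finset.sum_add_distrib, ← Finset.sum_div, Finset.sum_sub_distrib] at hsum
  rw [← hIW, ← hIU, ← hIV, htotal] at hsum
  exact hsum.trans (add_le_of_nonpos_right (div_nonpos_of_nonpos_of_nonneg (by linarith) hlog.le))

lemma isDist_delW {d : ℝ} (hd : d ∈ Set.Icc (0 : ℝ) 1) {n : ℕ} (x : Fin n → Bool) :
    IsDist (delW d x) := by
  refine ⟨fun y => Finset.sum_nonneg fun S _ => ?_, ?_⟩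
  · have := sub_nonneg.2 hd.2
    have := hd.1
    split_ifs <;> positivity
  · simp only [delW]
    rw [Finset.sum_comm]
    simp [Fin.sum_pow_mul_eq_add_pow]

/-- Concatenation of two channel outputs. -/
def DelOut.append {n m : ℕ} (y : DelOut n) (z : DelOut m) : DelOut (n + m) :=
  ⟨⟨y.1 + z.1, by omega⟩, Fin.append y.2 z.2⟩

/-- The string underlying a channel output. -/
def DelOut.toList {n : ℕ} (y : DelOut n) : List Bool := List.ofFn y.2

lemma DelOut.toList_injective {n : ℕ} : Function.Injective (DelOut.toList (n := n)) := by
  rintro ⟨⟨k, hk⟩, f⟩ ⟨⟨l, hl⟩, g⟩ h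
  obtain rfl : k = l := by simpa [DelOut.toList] using congrArg List.length h
  obtain rfl : f = g := List.ofFn_injective h
  rfl

lemma DelOut.toList_append {n m : ℕ} (y : DelOut n) (z : DelOut m) :
    (y.append z).toList = y.toList ++ z.toList :=
  List.ofFn_fin_append y.2 z.2

lemma toList_restrictSub {n : ℕ} (x : Fin n → Bool) (S : Finset (Fin n)) :
    (restrictSub x S).toList = S.sort.map x := by
  rw [← Finset.listMap_orderEmbOfFin_finRange S rfl, List.map_map]
  exact List.ofFn_eq_map

/-- Subsets of `Fin (n + m)` as pairs of a subset of the first `n` and one of the last `m`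
positions. -/
def finsetFinAddEquiv (n m : ℕ) : Finset (Fin n) × Finset (Fin m) ≃ Finset (Fin (n + m)) :=
  Finset.sumEquiv.symm.toEquiv.trans finSumFinEquiv.finsetCongr

lemma mem_finsetFinAddEquiv {n m : ℕ} (S : Finset (Fin n) × Finset (Fin m)) (i : Fin (n + m)) :
    i ∈ finsetFinAddEquiv n m S ↔
      (∃ a ∈ S.1, Fin.castAdd m a = i) ∨ ∃ b ∈ S.2, Fin.natAdd n b = i := by
  simp [finsetFinAddEquiv, Finset.mem_disjSum, Equiv.eq_symm_apply]

lemma card_finsetFinAddEquiv {n m : ℕ} (S : Finset (Fin n) × Finset (Fin m)) :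
    (finsetFinAddEquiv n m S).card = S.1.card + S.2.card := by
  simp [finsetFinAddEquiv]

lemma sort_finsetFinAddEquiv {n m : ℕ} (S : Finset (Fin n) × Finset (Fin m)) :
    (finsetFinAddEquiv n m S).sort =
      S.1.sort.map (Fin.castAdd m) ++ S.2.sort.map (Fin.natAdd n) := by
  have hlt : (S.1.sort.map (Fin.castAdd m) ++ S.2.sort.map (Fin.natAdd n)).Pairwise (· < ·) := by
    rw [List.pairwise_append]
    refine ⟨(Finset.sortedLT_sort _).pairwise.map _ fun a b h => h,
      (Finset.sortedLT_sort _).pairwise.map _ fun a b h => ?_, ?_⟩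
    · simpa using h
    · simp only [List.mem_map]
      rintro _ ⟨a, -, rfl⟩ _ ⟨b, -, rfl⟩
      simp only [Fin.lt_def, Fin.val_castAdd, Fin.val_natAdd]
      omega
  refine List.Perm.eq_of_pairwise' (r := (· ≤ ·)) (Finset.pairwise_sort _ _)
    (hlt.imp le_of_lt) ?_
  rw [List.perm_ext_iff_of_nodup (Finset.sort_nodup _ _) (hlt.imp ne_of_lt)]
  simp [mem_finsetFinAddEquiv]

lemma restrictSub_finsetFinAddEquiv {n m : ℕ} (x : Fin (n + m) → Bool)
    (S : Finset (Fin n) × Finset (Fin m)) :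
    restrictSub x (finsetFinAddEquiv n m S) =
      (restrictSub (x ∘ Fin.castAdd m) S.1).append (restrictSub (x ∘ Fin.natAdd n) S.2) := by
  apply DelOut.toList_injective
  simp [DelOut.toList_append, toList_restrictSub, sort_finsetFinAddEquiv]

/-- The deletion channel on `n + m` bits concatenates the outputs of independent deletion
channels on the first `n` and the last `m` bits. -/
lemma delW_add {n m : ℕ} (d : ℝ) (x : Fin (n + m) → Bool) (y : DelOut (n + m)) :
    delW d x y = ∑ z : DelOut n × DelOut m, if z.1.append z.2 = y then
      delW d (x ∘ Fin.castAdd m) z.1 * delW d (x ∘ Fin.natAdd n) z.2 else 0 := by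
  have hweight (S : Finset (Fin n) × Finset (Fin m)) :
      (1 - d) ^ (finsetFinAddEquiv n m S).card * d ^ (n + m - (finsetFinAddEquiv n m S).card) =
      ((1 - d) ^ S.1.card * d ^ (n - S.1.card)) * ((1 - d) ^ S.2.card * d ^ (m - S.2.card)) := by
    have h₁ : S.1.card ≤ n := by simpa using Finset.card_le_univ S.1
    have h₂ : S.2.card ≤ m := by simpa using Finset.card_le_univ S.2
    rw [card_finsetFinAddEquiv,
      show n + m - (S.1.card + S.2.card) = (n - S.1.card) + (m - S.2.card) by omega,
      pow_add, pow_add]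
    ring
  have hexpand (z : DelOut n × DelOut m) : (if z.1.append z.2 = y then
      delW d (x ∘ Fin.castAdd m) z.1 * delW d (x ∘ Fin.natAdd n) z.2 else 0) =
      ∑ S : Finset (Fin n) × Finset (Fin m),
        if (restrictSub (x ∘ Fin.castAdd m) S.1, restrictSub (x ∘ Fin.natAdd n) S.2) = z then
          if z.1.append z.2 = y then
            ((1 - d) ^ S.1.card * d ^ (n - S.1.card)) * ((1 - d) ^ S.2.card * d ^ (m - S.2.card))
          else 0
        else 0 := by
    split_ifs
    · rw [delW, delW, Finset.sum_mul_sum, Fintype.sum_prod_type]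
      simp only [Prod.ext_iff, ite_zero_mul_ite_zero]
    · simp
  simp_rw [hexpand]
  rw [Finset.sum_comm, delW, ← (finsetFinAddEquiv n m).sum_comp]
  refine Finset.sum_congr rfl fun S _ => ?_
  simp only [Finset.sum_ite_eq, Finset.mem_univ, if_true, hweight,
    restrictSub_finsetFinAddEquiv]

lemma bddAbove_mutualInfo_delW {d : ℝ} (hd : d ∈ Set.Icc (0 : ℝ) 1) (n : ℕ) :
    BddAbove (Set.range fun p : {p : (Fin n → Bool) → ℝ // IsDist p} =>
      mutualInfo p.1 (delW d)) :=
  ⟨_, Set.forall_mem_range.2 fun p => mutualInfo_le_card_div_log p.2.1 (isDist_delW hd)⟩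

lemma natCast_mul_Cn {n : ℕ} (hn : 1 ≤ n) (d : ℝ) :
    (n : ℝ) * Cn n d =
      ⨆ p : {p : (Fin n → Bool) → ℝ // IsDist p}, mutualInfo p.1 (delW d) := by
  have : (n : ℝ) ≠ 0 := by positivity
  rw [Cn, ← mul_assoc, mul_one_div_cancel this, one_mul]

instance nonempty_isDist (α : Type*) [Fintype α] [DecidableEq α] [Nonempty α] :
    Nonempty {p : α → ℝ // IsDist p} :=
  ⟨⟨Pi.single (Classical.arbitrary α) 1, fun a => by
    by_cases h : a = Classical.arbitrary α <;> simp [h], by simp⟩⟩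

/-- For every `d ∈ [0,1]` and all integers `n, m ≥ 1`, the quantity
`n·C_n(d)` is subadditive: `(n+m)·C_{n+m}(d) ≤ n·C_n(d) + m·C_m(d)`. -/
theorem deletion_capacity_subadditive (d : ℝ) (hd : d ∈ Set.Icc (0 : ℝ) 1)
    (n m : ℕ) (hn : 1 ≤ n) (hm : 1 ≤ m) :
    ((n + m : ℕ) : ℝ) * Cn (n + m) d ≤ (n : ℝ) * Cn n d + (m : ℝ) * Cn m d := by
  rw [natCast_mul_Cn (by omega), natCast_mul_Cn hn, natCast_mul_Cn hm]
  refine ciSup_le fun p => ?_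
  refine (mutualInfo_le_add p.2 (fun x => isDist_delW hd (x ∘ Fin.castAdd m))
    (fun x => isDist_delW hd (x ∘ Fin.natAdd n)) (fun z => z.1.append z.2) (delW_add d)).trans ?_
  rw [← mutualInfo_pushDist (fun x => x ∘ Fin.castAdd m) p.1 (delW d),
    ← mutualInfo_pushDist (fun x => x ∘ Fin.natAdd n) p.1 (delW d)]
  exact add_le_add
    (le_ciSup (bddAbove_mutualInfo_delW hd n) ⟨_, p.2.pushDist _⟩)
    (le_ciSup (bddAbove_mutualInfo_delW hd m) ⟨_, p.2.pushDist _⟩)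
end
end

section
/- For all integers 0 ≤ k₂ ≤ k₁ ≤ n, the exact deletion channel W_{n,k₂} is the cascade of W_{n,k₁} followed by W_{k₁,k₂}: for every x ∈ {0,1}^n and every y ∈ {0,1}^{k₂}, #{U ⊆ {1,…,n} : |U| = k₂, x|_U = y} / C(n,k₂) = Σ_{z ∈ {0,1}^{k₁}} [#{T ⊆ {1,…,k₁} : |T| = k₂, z|_T = y} / C(k₁,k₂)] · [#{S ⊆ {1,…,n} : |S| = k₁, x|_S = z} / C(n,k₁)], where C(a,b) denotes the binomial coefficient a choose b. -/
open scoped BigOperators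

noncomputable section

/-- A strictly monotone `f : Fin k → Fin n` factors through `Fin m` as a composition of strictly
monotone maps in exactly `(n - k).choose (m - k)` ways: one for each `m`-subset of `Fin n`
containing the range of `f`. -/
theorem card_strictMono_factorizations {n m k : ℕ} (hkm : k ≤ m) {f : Fin k → Fin n}
    (hf : StrictMono f) :
    (Finset.univ.filter fun p : (Fin k → Fin m) × (Fin m → Fin n) =>
      StrictMono p.1 ∧ StrictMono p.2 ∧ p.2 ∘ p.1 = f).card = (n - k).choose (m - k) := by
  have hcard : (Finset.univ.image f).card = k := by
    simp [Finset.card_image_of_injective _ hf.injective]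
  have hsup := Finset.card_filter_powersetCard_subset (Finset.univ.image f)
    (Finset.univ : Finset (Fin n)) m (Finset.subset_univ _) (hcard.trans_le hkm)
  rw [hcard, Finset.card_univ, Fintype.card_fin] at hsup
  rw [← hsup]
  refine Finset.card_bij (fun p _ => Finset.univ.image p.2) ?_ ?_ ?_
  · rintro ⟨g, h⟩ hp
    simp only [Finset.mem_filter, Finset.mem_univ, true_and] at hp
    obtain ⟨-, hh, rfl⟩ := hp
    simp only [Finset.mem_filter, Finset.mem_powersetCard, Finset.subset_univ, true_and]
    refine ⟨by simp [Finset.card_image_of_injective _ hh.injective], ?_⟩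
    rw [← Finset.image_image]
    exact Finset.image_subset_image (Finset.subset_univ _)
  · rintro ⟨g, h⟩ hp ⟨g', h'⟩ hp' heq
    simp only [Finset.mem_filter, Finset.mem_univ, true_and] at hp hp'
    obtain ⟨-, hh, rfl⟩ := hp
    obtain ⟨-, hh', hcomp⟩ := hp'
    obtain rfl : h = h' := by
      refine (StrictMono.range_inj hh hh').1 ?_
      simpa using congrArg (fun s : Finset (Fin n) => (s : Set (Fin n))) heq
    rw [hh.injective.comp_left hcomp]
  · intro S hS
    simp only [Finset.mem_filter, Finset.mem_powersetCard, Finset.subset_univ, true_and] at hS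
    obtain ⟨hSm, hfS⟩ := hS
    have hmem : ∀ i, f i ∈ S := fun i => hfS (Finset.mem_image_of_mem f (Finset.mem_univ i))
    refine ⟨(fun i => (S.orderIsoOfFin hSm).symm ⟨f i, hmem i⟩, S.orderEmbOfFin hSm), ?_, ?_⟩
    · simp only [Finset.mem_filter, Finset.mem_univ, true_and]
      refine ⟨fun i j hij => (S.orderIsoOfFin hSm).symm.strictMono (hf hij),
        (S.orderEmbOfFin hSm).strictMono, ?_⟩
      funext i
      simp [← Finset.coe_orderIsoOfFin_apply]
    · simp

/-- Counting the embeddings of `y` into `x` through an intermediate string `z` counts every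
embedding of `y` into `x` exactly `(n - k).choose (m - k)` times. -/
theorem sum_card_strictMono_mul_card_strictMono {α : Type*} [Fintype α] [DecidableEq α]
    {n m k : ℕ} (hkm : k ≤ m) (x : Fin n → α) (y : Fin k → α) :
    ∑ z : Fin m → α,
      (Finset.univ.filter fun g : Fin k → Fin m => StrictMono g ∧ z ∘ g = y).card *
        (Finset.univ.filter fun h : Fin m → Fin n => StrictMono h ∧ x ∘ h = z).card =
      (Finset.univ.filter fun f : Fin k → Fin n => StrictMono f ∧ x ∘ f = y).card *
        (n - k).choose (m - k) := by
  let P := Finset.univ.filter fun p : (Fin k → Fin m) × (Fin m → Fin n) =>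
    StrictMono p.1 ∧ StrictMono p.2 ∧ x ∘ p.2 ∘ p.1 = y
  trans P.card
  · rw [Finset.card_eq_sum_card_fiberwise (f := fun p => x ∘ p.2) (t := Finset.univ)
      (fun _ _ => Finset.mem_coe.2 (Finset.mem_univ _))]
    refine Finset.sum_congr rfl fun z _ => ?_
    rw [← Finset.card_product]
    congr 1
    ext ⟨g, h⟩
    simp only [P, Finset.mem_product, Finset.mem_filter, Finset.mem_univ, true_and]
    constructor
    · rintro ⟨⟨hg, hy⟩, hh, rfl⟩
      exact ⟨⟨hg, hh, hy⟩, rfl⟩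
    · rintro ⟨⟨hg, hh, hy⟩, rfl⟩
      exact ⟨⟨hg, hy⟩, hh, rfl⟩
  · rw [Finset.card_eq_sum_card_fiberwise (f := fun p => p.2 ∘ p.1)
      (t := Finset.univ.filter fun f : Fin k → Fin n => StrictMono f ∧ x ∘ f = y)]
    · rw [← smul_eq_mul]
      refine Finset.sum_eq_card_nsmul fun f hf => ?_
      simp only [Finset.mem_filter, Finset.mem_univ, true_and] at hf
      rw [← card_strictMono_factorizations hkm hf.1]
      congr 1
      ext ⟨g, h⟩
      simp only [P, Finset.mem_filter, Finset.mem_univ, true_and]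
      constructor
      · rintro ⟨⟨hg, hh, -⟩, hgh⟩
        exact ⟨hg, hh, hgh⟩
      · rintro ⟨hg, hh, rfl⟩
        exact ⟨⟨hg, hh, hf.2⟩, rfl⟩
    · intro p hp
      simp only [P, Finset.coe_filter, Finset.mem_univ, true_and, Set.mem_ofPred_eq] at hp ⊢
      exact ⟨hp.2.1.comp hp.1, hp.2.2⟩

/-- For `0 ≤ k₂ ≤ k₁ ≤ n`, the exact deletion channel `W_{n,k₂}` is the
cascade of `W_{n,k₁}` followed by `W_{k₁,k₂}`:
`P_{n,k₂}(y|x) = Σ_z P_{k₁,k₂}(y|z) · P_{n,k₁}(z|x)`. -/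
theorem exactW_cascade (n k₁ k₂ : ℕ) (h21 : k₂ ≤ k₁) (h1n : k₁ ≤ n)
    (x : Fin n → Bool) (y : Fin k₂ → Bool) :
    exactW x y = ∑ z : Fin k₁ → Bool, exactW z y * exactW x z := by
  have hcount := congrArg (Nat.cast (R := ℝ)) (sum_card_strictMono_mul_card_strictMono h21 x y)
  have hchoose := congrArg (Nat.cast (R := ℝ)) (Nat.choose_mul (n := n) h21)
  have hn2 : (n.choose k₂ : ℝ) ≠ 0 := mod_cast (Nat.choose_pos (h21.trans h1n)).ne'
  have hn1 : (n.choose k₁ : ℝ) ≠ 0 := mod_cast (Nat.choose_pos h1n).ne'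
  have h12 : (k₁.choose k₂ : ℝ) ≠ 0 := mod_cast (Nat.choose_pos h21).ne'
  push_cast at hcount hchoose
  simp only [exactW, div_mul_div_comm]
  rw [← Finset.sum_div, hcount, div_eq_div_iff hn2 (mul_ne_zero h12 hn1),
    mul_comm (k₁.choose k₂ : ℝ), hchoose]
  ring
end
end

section
/- For all integers 0 ≤ k₂ ≤ k₁ ≤ n and every probability distribution on inputs X ∈ {0,1}^n, the mutual information satisfies I(X; W_{n,k₁}(X)) ≥ I(X; W_{n,k₂}(X)). -/
open scoped BigOperators

noncomputable section

open Finset in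
/-- The number of strictly monotone maps `Fin k → Fin n` is `n.choose k`. -/
theorem card_filter_strictMono (n k : ℕ) :
    #{f : Fin k → Fin n | StrictMono f} = n.choose k := by
  have h : #(powersetCard k (univ : Finset (Fin n))) = n.choose k := by simp
  rw [← h]
  refine card_bij (fun f _ => univ.image f) ?_ ?_ ?_
  · intro f hf
    simp only [mem_filter_univ] at hf
    simp [mem_powersetCard, card_image_of_injective _ hf.injective]
  · intro f hf g hg hfg
    simp only [mem_filter_univ] at hf hg
    rw [← hf.range_inj hg]
    simpa using congrArg (fun s : Finset (Fin n) => (s : Set (Fin n))) hfg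
  · intro s hs
    have hs' : #s = k := (mem_powersetCard.1 hs).2
    exact ⟨s.orderEmbOfFin hs', by simp [(s.orderEmbOfFin hs').strictMono],
      image_orderEmbOfFin_univ s hs'⟩

open Finset in
/-- A strictly monotone `h : Fin k → Fin n` factors through `Fin m` by strictly monotone maps in
exactly `(n - k).choose (m - k)` ways. -/
theorem card_strictMono_factorizations_s7 {n m k : ℕ} (hkm : k ≤ m) {h : Fin k → Fin n}
    (hh : StrictMono h) :
    #{q : (Fin m → Fin n) × (Fin k → Fin m) |
      StrictMono q.1 ∧ StrictMono q.2 ∧ q.1 ∘ q.2 = h} = (n - k).choose (m - k) := by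
  have himg : #(univ.image h) = k := by simp [card_image_of_injective _ hh.injective]
  have hcard : #(powersetCard (m - k) (univ.image h)ᶜ) = (n - k).choose (m - k) := by
    rw [card_powersetCard, card_compl, himg, Fintype.card_fin]
  have hsub : ∀ {f : Fin m → Fin n} {g : Fin k → Fin m}, f ∘ g = h →
      univ.image h ⊆ univ.image f := by
    rintro f g rfl a ha
    obtain ⟨i, -, rfl⟩ := mem_image.1 ha
    exact mem_image_of_mem f (mem_univ (g i))
  rw [← hcard]
  refine card_bij (fun q _ => univ.image q.1 \ univ.image h) ?_ ?_ ?_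
  · rintro ⟨f, g⟩ hfg
    obtain ⟨hf, -, hc⟩ := (mem_filter_univ _).1 hfg
    rw [mem_powersetCard]
    refine ⟨fun a ha => mem_compl.2 (mem_sdiff.1 ha).2, ?_⟩
    rw [card_sdiff_of_subset (hsub hc), himg, card_image_of_injective _ hf.injective, card_univ,
      Fintype.card_fin]
  · rintro ⟨f, g⟩ hfg ⟨f', g'⟩ hfg' heq
    obtain ⟨hf, -, hc⟩ := (mem_filter_univ _).1 hfg
    obtain ⟨hf', -, hc'⟩ := (mem_filter_univ _).1 hfg'
    dsimp only at hf hc hf' hc' heq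
    have himage : univ.image f = univ.image f' := by
      rw [← sdiff_union_of_subset (hsub hc), heq, sdiff_union_of_subset (hsub hc')]
    have hff' : f = f' := by
      rw [← hf.range_inj hf']
      simpa using congrArg (fun s : Finset (Fin n) => (s : Set (Fin n))) himage
    subst hff'
    rw [hf.injective.comp_left (hc.trans hc'.symm)]
  · intro t ht
    obtain ⟨hts, htc⟩ := mem_powersetCard.1 ht
    have hdisj : Disjoint t (univ.image h) :=
      disjoint_left.2 fun a ha => mem_compl.1 (hts ha)
    have hs : #(t ∪ univ.image h) = m := by
      rw [card_union_of_disjoint hdisj, htc, himg, Nat.sub_add_cancel hkm]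
    have hmem : ∀ i, h i ∈ t ∪ univ.image h := fun i =>
      mem_union_right _ (mem_image_of_mem h (mem_univ i))
    let e := (t ∪ univ.image h).orderIsoOfFin hs
    refine ⟨((t ∪ univ.image h).orderEmbOfFin hs, fun i => e.symm ⟨h i, hmem i⟩), ?_, ?_⟩
    · refine (mem_filter_univ _).2 ⟨OrderEmbedding.strictMono _, ?_, ?_⟩
      · exact fun i j hij => e.symm.strictMono (hh hij)
      · funext i
        simp [e, ← coe_orderIsoOfFin_apply]
    · simp only [image_orderEmbOfFin_univ]
      exact union_sdiff_cancel_right hdisj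

open Finset in
/-- Counting embeddings of `z` into `x` through intermediate strings `y` of length `m`. -/
theorem sum_card_embeddings_mul {n m k : ℕ} (hkm : k ≤ m) (x : Fin n → Bool) (z : Fin k → Bool) :
    ∑ y : Fin m → Bool, #{f : Fin m → Fin n | StrictMono f ∧ x ∘ f = y} *
        #{g : Fin k → Fin m | StrictMono g ∧ y ∘ g = z} =
      #{h : Fin k → Fin n | StrictMono h ∧ x ∘ h = z} * (n - k).choose (m - k) := by
  let P : Finset ((Fin m → Fin n) × (Fin k → Fin m)) :=
    {q | StrictMono q.1 ∧ StrictMono q.2 ∧ x ∘ q.1 ∘ q.2 = z}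
  have hleft : #P = ∑ y : Fin m → Bool, #{f : Fin m → Fin n | StrictMono f ∧ x ∘ f = y} *
      #{g : Fin k → Fin m | StrictMono g ∧ y ∘ g = z} := by
    rw [card_eq_sum_card_fiberwise (f := fun q => x ∘ q.1) (t := univ) (by simp)]
    refine sum_congr rfl fun y _ => ?_
    rw [← card_product]
    congr 1
    ext ⟨f, g⟩
    simp only [P, mem_filter, mem_univ, true_and, mem_product]
    constructor
    · rintro ⟨⟨hf, hg, hz⟩, rfl⟩
      exact ⟨⟨hf, rfl⟩, hg, hz⟩
    · rintro ⟨⟨hf, rfl⟩, hg, hz⟩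
      exact ⟨⟨hf, hg, hz⟩, rfl⟩
  rw [← hleft, card_eq_sum_card_fiberwise (f := fun q => q.1 ∘ q.2)
    (t := {h : Fin k → Fin n | StrictMono h ∧ x ∘ h = z})]
  · refine sum_const_nat fun h hh => ?_
    obtain ⟨hmono, hz⟩ := (mem_filter_univ _).1 hh
    rw [← card_strictMono_factorizations_s7 hkm hmono]
    congr 1
    ext ⟨f, g⟩
    simp only [P, mem_filter, mem_univ, true_and]
    constructor
    · rintro ⟨⟨hf, hg, -⟩, rfl⟩
      exact ⟨hf, hg, rfl⟩
    · rintro ⟨hf, hg, rfl⟩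
      exact ⟨⟨hf, hg, hz⟩, rfl⟩
  · rintro ⟨f, g⟩ hfg
    obtain ⟨hf, hg, hz⟩ := (mem_filter_univ _).1 hfg
    simpa using ⟨hf.comp hg, hz⟩

theorem exactW_nonneg {n k : ℕ} (x : Fin n → Bool) (y : Fin k → Bool) : 0 ≤ exactW x y := by
  unfold exactW
  positivity

theorem sum_exactW {n k : ℕ} (hk : k ≤ n) (x : Fin n → Bool) :
    ∑ y : Fin k → Bool, exactW x y = 1 := by
  have hpos : (n.choose k : ℝ) ≠ 0 := by exact_mod_cast (Nat.choose_pos hk).ne'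
  unfold exactW
  rw [← Finset.sum_div, div_eq_one_iff_eq hpos, ← card_filter_strictMono n k,
    Finset.card_eq_sum_card_fiberwise (f := fun f => x ∘ f) (t := Finset.univ) (by simp)]
  push_cast
  simp only [Finset.filter_filter]

/-- The exact deletion channels compose: keeping `m` of `n` bits and then `k` of these `m` bits
amounts to keeping `k` of `n` bits. -/
theorem exactW_eq_sum_mul {n m k : ℕ} (hkm : k ≤ m) (hmn : m ≤ n) (x : Fin n → Bool)
    (z : Fin k → Bool) :
    exactW x z = ∑ y : Fin m → Bool, exactW x y * exactW y z := by
  have h₁ : (n.choose m : ℝ) ≠ 0 := by exact_mod_cast (Nat.choose_pos hmn).ne'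
  have h₂ : (m.choose k : ℝ) ≠ 0 := by exact_mod_cast (Nat.choose_pos hkm).ne'
  have h₃ : (n.choose k : ℝ) ≠ 0 := by exact_mod_cast (Nat.choose_pos (hkm.trans hmn)).ne'
  have hchoose : (n.choose m * m.choose k : ℝ) = n.choose k * (n - k).choose (m - k) := by
    exact_mod_cast Nat.choose_mul hkm
  have hcount := congrArg (Nat.cast : ℕ → ℝ) (sum_card_embeddings_mul hkm x z)
  push_cast at hcount
  unfold exactW
  simp_rw [div_mul_div_comm]
  rw [← Finset.sum_div, hcount, div_eq_div_iff h₃ (mul_ne_zero h₁ h₂), hchoose]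
  ring

/-- **Log-sum inequality**, for sums weighted by `v`. -/
theorem log_sum_le {β : Type*} [Fintype β] {w q v : β → ℝ} (hw : ∀ y, 0 ≤ w y)
    (hq : ∀ y, 0 ≤ q y) (hv : ∀ y, 0 ≤ v y) (hac : ∀ y, q y = 0 → w y = 0) :
    (∑ y, w y * v y) * Real.log ((∑ y, w y * v y) / ∑ y, q y * v y) ≤
      ∑ y, w y * v y * Real.log (w y / q y) := by
  set A := ∑ y, w y * v y with hA
  set B := ∑ y, q y * v y with hB
  have hwv : ∀ y ∈ Finset.univ, 0 ≤ w y * v y := fun y _ => mul_nonneg (hw y) (hv y)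
  have hqv : ∀ y ∈ Finset.univ, 0 ≤ q y * v y := fun y _ => mul_nonneg (hq y) (hv y)
  rcases (Finset.sum_nonneg hwv).eq_or_lt with hA0 | hApos
  · have hzero := (Finset.sum_eq_zero_iff_of_nonneg hwv).1 hA0.symm
    rw [hA, ← hA0, zero_mul]
    exact Finset.sum_nonneg fun y hy => by rw [hzero y hy, zero_mul]
  have hBpos : 0 < B := by
    refine (Finset.sum_nonneg hqv).lt_of_ne fun hB0 => hApos.ne' ?_
    have hzero := (Finset.sum_eq_zero_iff_of_nonneg hqv).1 hB0.symm
    refine Finset.sum_eq_zero fun y hy => ?_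
    rcases mul_eq_zero.1 (hzero y hy) with h | h
    · rw [hac y h, zero_mul]
    · rw [h, mul_zero]
  rw [← hA] at hApos
  have hterm : ∀ y, w y * v y * Real.log (A / B) + w y * v y - q y * v y * (A / B) ≤
      w y * v y * Real.log (w y / q y) := by
    intro y
    rcases (hw y).eq_or_lt with hw0 | hwpos
    · have : 0 ≤ q y * v y * (A / B) := by
        have := hqv y (Finset.mem_univ y)
        positivity
      simp only [← hw0, zero_mul]
      linarith
    have hqpos : 0 < q y := (hq y).lt_of_ne fun h => hwpos.ne' (hac y h.symm)
    have hlog := Real.one_sub_inv_le_log_of_pos (div_pos (div_pos hwpos hqpos) (div_pos hApos hBpos))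
    rw [Real.log_div (div_pos hwpos hqpos).ne' (div_pos hApos hBpos).ne'] at hlog
    have hmul := mul_le_mul_of_nonneg_left hlog (hwv y (Finset.mem_univ y))
    have hsimp : w y * v y * (1 - (w y / q y / (A / B))⁻¹) =
        w y * v y - q y * v y * (A / B) := by
      field_simp
    rw [hsimp] at hmul
    linarith
  calc A * Real.log (A / B)
      = ∑ y, (w y * v y * Real.log (A / B) + w y * v y - q y * v y * (A / B)) := by
        rw [Finset.sum_sub_distrib, Finset.sum_add_distrib, ← Finset.sum_mul, ← Finset.sum_mul,
          ← hA, ← hB, mul_div_cancel₀ _ hBpos.ne']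
        ring
    _ ≤ _ := Finset.sum_le_sum fun y _ => hterm y

/-- **Data processing inequality**: post-processing the output of the channel `W` by a channel `V`
does not increase the mutual information. -/
theorem mutualInfo_comp_le {α β γ : Type*} [Fintype α] [Fintype β] [Fintype γ] {p : α → ℝ}
    {W : α → β → ℝ} {V : β → γ → ℝ} (hp : ∀ x, 0 ≤ p x) (hW : ∀ x y, 0 ≤ W x y)
    (hV : ∀ y z, 0 ≤ V y z) (hV1 : ∀ y, ∑ z, V y z = 1) :
    mutualInfo p (fun x z => ∑ y, W x y * V y z) ≤ mutualInfo p W := by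
  unfold mutualInfo
  refine Finset.sum_le_sum fun x _ => ?_
  rcases (hp x).eq_or_lt with hx | hx
  · simp [← hx]
  have hqnonneg : ∀ y, ∀ x' ∈ Finset.univ, 0 ≤ p x' * W x' y := fun y x' _ =>
    mul_nonneg (hp x') (hW x' y)
  have hmarginal : ∀ z, ∑ x', p x' * ∑ y, W x' y * V y z =
      ∑ y, (∑ x', p x' * W x' y) * V y z := by
    intro z
    simp_rw [Finset.mul_sum, Finset.sum_mul, mul_assoc]
    exact Finset.sum_comm
  have hac : ∀ y, ∑ x', p x' * W x' y = 0 → W x y = 0 := fun y h =>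
    (mul_eq_zero.1 ((Finset.sum_eq_zero_iff_of_nonneg (hqnonneg y)).1 h x
      (Finset.mem_univ x))).resolve_left hx.ne'
  have hlog2 : 0 ≤ p x / Real.log 2 := div_nonneg hx.le (Real.log_nonneg one_le_two)
  calc ∑ z, p x * (∑ y, W x y * V y z) *
        Real.logb 2 ((∑ y, W x y * V y z) / ∑ x', p x' * ∑ y, W x' y * V y z)
      = ∑ z, p x / Real.log 2 * ((∑ y, W x y * V y z) *
          Real.log ((∑ y, W x y * V y z) / ∑ y, (∑ x', p x' * W x' y) * V y z)) := by
        refine Finset.sum_congr rfl fun z _ => ?_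
        rw [hmarginal, Real.logb]
        ring
    _ ≤ ∑ z, p x / Real.log 2 *
          ∑ y, W x y * V y z * Real.log (W x y / ∑ x', p x' * W x' y) :=
        Finset.sum_le_sum fun z _ => mul_le_mul_of_nonneg_left
          (log_sum_le (hW x) (fun y => Finset.sum_nonneg (hqnonneg y)) (fun y => hV y z) hac) hlog2
    _ = ∑ y, p x * W x y * Real.logb 2 (W x y / ∑ x', p x' * W x' y) := by
        simp_rw [Finset.mul_sum]
        rw [Finset.sum_comm]
        refine Finset.sum_congr rfl fun y _ => ?_
        rw [← mul_one (p x * W x y * _), ← hV1 y, Finset.mul_sum]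
        refine Finset.sum_congr rfl fun z _ => ?_
        rw [Real.logb]
        ring

/-- For `0 ≤ k₂ ≤ k₁ ≤ n` and every input distribution `p` on `{0,1}^n`,
`I(X; W_{n,k₁}(X)) ≥ I(X; W_{n,k₂}(X))`. -/
theorem mutualInfo_exactW_mono (n k₁ k₂ : ℕ) (h21 : k₂ ≤ k₁) (h1n : k₁ ≤ n)
    (p : (Fin n → Bool) → ℝ) (hp : IsDist p) :
    mutualInfo p (exactW (n := n) (k := k₂)) ≤ mutualInfo p (exactW (n := n) (k := k₁)) := by
  rw [show exactW (n := n) (k := k₂) = fun x z => ∑ y : Fin k₁ → Bool, exactW x y * exactW y z from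
    funext fun x => funext fun z => exactW_eq_sum_mul h21 h1n x z]
  exact mutualInfo_comp_le hp.1 exactW_nonneg exactW_nonneg (sum_exactW h21)
end
end
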